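/- arXiv:2412.01008 — 2 statements merged into one kernel-verified Lean document; each statement's English description precedes it below -/
import Mathlib

section
/- Let (Ω, F, P) be a probability space, M ≥ 1, and let e_1, …, e_M : Ω → [0, ∞) be measurable with E[e_m] ≤ 1 for every m (i.e., each e_m is an e-value). Let σ be a (data-dependent, measurable) permutation of {1, …, M} that sorts the values from largest to smallest, so that e_{σ(1)}(ω) ≥ e_{σ(2)}(ω) ≥ … ≥ e_{σ(M)}(ω) for every ω. Define the merged e-value Ḡ_M = (1/M) Σ_{m=1}^M (m/M) · e_{σ(m)}. Then for every α ∈ (0, 1], P(Ḡ_M ≥ 1/α) ≤ α. -/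
open MeasureTheory

/-- Markov's inequality for an e-value `W`: `P(W ≥ 1/α) ≤ α`. -/
lemma measure_one_div_le_of_lintegral_le_one {Ω : Type*} [MeasurableSpace Ω] {μ : Measure Ω}
    {W : Ω → ℝ} (hW : Measurable W) (hint : ∫⁻ ω, ENNReal.ofReal (W ω) ∂μ ≤ 1)
    {α : ℝ} (hα : 0 < α) : μ {ω | 1 / α ≤ W ω} ≤ ENNReal.ofReal α := by
  have hpos : 0 < 1 / α := by positivity
  calc μ {ω | 1 / α ≤ W ω}
      ≤ μ {ω | ENNReal.ofReal (1 / α) ≤ ENNReal.ofReal (W ω)} :=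
        measure_mono fun ω hω => ENNReal.ofReal_le_ofReal hω
    _ ≤ (∫⁻ ω, ENNReal.ofReal (W ω) ∂μ) / ENNReal.ofReal (1 / α) :=
        meas_ge_le_lintegral_div hW.ennreal_ofReal.aemeasurable
          (ENNReal.ofReal_pos.2 hpos).ne' ENNReal.ofReal_ne_top
    _ ≤ 1 / ENNReal.ofReal (1 / α) := by gcongr
    _ = ENNReal.ofReal α := by
        rw [one_div, one_div, ENNReal.ofReal_inv_of_pos hα, inv_inv]

/-- The arithmetic mean of e-values is an e-value. -/
lemma lintegral_average_le_one {Ω : Type*} [MeasurableSpace Ω] {μ : Measure Ω} {M : ℕ}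
    (hM : 1 ≤ M) {e : Fin M → Ω → ℝ} (he_meas : ∀ m, Measurable (e m))
    (he_nonneg : ∀ m ω, 0 ≤ e m ω) (he_val : ∀ m, ∫⁻ ω, ENNReal.ofReal (e m ω) ∂μ ≤ 1) :
    ∫⁻ ω, ENNReal.ofReal ((1 / (M : ℝ)) * ∑ m, e m ω) ∂μ ≤ 1 := by
  have hM0 : (0 : ℝ) < M := by exact_mod_cast hM
  have hsplit (ω : Ω) : ENNReal.ofReal ((1 / (M : ℝ)) * ∑ m, e m ω)
      = (M : ENNReal)⁻¹ * ∑ m, ENNReal.ofReal (e m ω) := by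
    rw [ENNReal.ofReal_mul (by positivity), one_div, ENNReal.ofReal_inv_of_pos hM0,
      ENNReal.ofReal_natCast, ENNReal.ofReal_sum_of_nonneg fun m _ => he_nonneg m ω]
  simp_rw [hsplit]
  rw [lintegral_const_mul _ (Finset.measurable_sum _ fun m _ => (he_meas m).ennreal_ofReal),
    lintegral_finsetSum _ fun m _ => (he_meas m).ennreal_ofReal]
  calc (M : ENNReal)⁻¹ * ∑ m, ∫⁻ ω, ENNReal.ofReal (e m ω) ∂μ
      ≤ (M : ENNReal)⁻¹ * ∑ _m : Fin M, 1 := by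
        gcongr with m
        exact he_val m
    _ = 1 := by
        simpa using ENNReal.inv_mul_cancel (by exact_mod_cast (by omega : M ≠ 0))
          (ENNReal.natCast_ne_top M)

/-- The rank weights `m / M` are at most one, so a rank-weighted sum of nonnegative numbers,
taken in any order, is at most their plain sum. -/
lemma sum_rank_weight_mul_perm_le {M : ℕ} (p : Equiv.Perm (Fin M)) {x : Fin M → ℝ}
    (hx : ∀ m, 0 ≤ x m) :
    ∑ m : Fin M, (((m : ℕ) + 1 : ℝ) / M) * x (p m) ≤ ∑ m, x m := by
  rw [← Equiv.sum_comp p x]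
  refine Finset.sum_le_sum fun m _ => mul_le_of_le_one_left (hx _) ?_
  exact div_le_one_of_le₀ (by exact_mod_cast m.isLt) (Nat.cast_nonneg M)

/-- Theorem 1 of the paper (size of the merged e-BH GUe-value): if `e 1, …, e M` are
e-values (nonnegative, expectation at most one) and `σ` is a measurable data-dependent
permutation sorting them from largest to smallest, then the merged statistic
`Ḡ_M = (1/M) ∑ m, (m/M) · e_{σ(m)}` satisfies `P(Ḡ_M ≥ 1/α) ≤ α` for all `α ∈ (0,1]`. -/
theorem merged_eBH_size {Ω : Type*} [MeasurableSpace Ω] (μ : Measure Ω)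
    [IsProbabilityMeasure μ] (M : ℕ) (hM : 1 ≤ M) (e : Fin M → Ω → ℝ)
    (he_meas : ∀ m, Measurable (e m)) (he_nonneg : ∀ m ω, 0 ≤ e m ω)
    (he_val : ∀ m, ∫⁻ ω, ENNReal.ofReal (e m ω) ∂μ ≤ 1)
    (σ : Ω → Equiv.Perm (Fin M))
    (hσ_meas : ∀ p : Equiv.Perm (Fin M), MeasurableSet {ω | σ ω = p})
    (hσ_sort : ∀ ω, ∀ i j : Fin M, i ≤ j → e (σ ω j) ω ≤ e (σ ω i) ω)
    (G : Ω → ℝ)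
    (hG : ∀ ω, G ω = (1 / (M : ℝ)) * ∑ m : Fin M, (((m : ℕ) + 1 : ℝ) / M) * e (σ ω m) ω)
    (α : ℝ) (hα : α ∈ Set.Ioc (0 : ℝ) 1) :
    μ {ω | 1 / α ≤ G ω} ≤ ENNReal.ofReal α := by
  refine (measure_mono fun ω (hω : 1 / α ≤ G ω) => ?_).trans
    (measure_one_div_le_of_lintegral_le_one
      (W := fun ω => (1 / (M : ℝ)) * ∑ m, e m ω)
      ((Finset.measurable_sum _ fun m _ => he_meas m).const_mul _)
      (lintegral_average_le_one hM he_meas he_nonneg he_val) hα.1)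
  refine hω.trans ?_
  rw [hG]
  exact mul_le_mul_of_nonneg_left
    (sum_rank_weight_mul_perm_le (σ ω) fun m => he_nonneg m ω) (by positivity)
end

section
/- Let (Ω, F, P) be a probability space, M ≥ 1, and let e_1, …, e_M : Ω → [0, ∞) be measurable random variables with arbitrary dependence. Let N ⊆ {1, …, M} be the set of true null hypotheses and assume E[e_i] ≤ 1 for every i ∈ N. For α ∈ (0, 1), the e-BH procedure sorts the e-values from largest to smallest as e_{(1)} ≥ … ≥ e_{(M)}, sets k* = max{m : m · e_{(m)} / M ≥ 1/α} (with k* = 0 and no rejections if this set is empty), and rejects the k* hypotheses with the largest e-values. Then the false discovery rate satisfies FDR = E[ |R ∩ N| / max(|R|, 1) ] ≤ α |N| / M ≤ α, where R denotes the (random) set of rejected hypotheses. -/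
open MeasureTheory

/-- The set rejected by the e-BH procedure is self-consistent: each rejected e-value `x j` is at
least `M / (α |R|)`. -/
theorem eBH_self_consistent {M : ℕ} (hM : 1 ≤ M) {α : ℝ} (hα : 0 < α) (x : Fin M → ℝ)
    (σ : Equiv.Perm (Fin M)) (hσ : ∀ i j : Fin M, i ≤ j → x (σ j) ≤ x (σ i))
    {k : ℕ} (hk : k = (Finset.univ.filter
      (fun i : Fin M => 1 / α ≤ ((i : ℕ) + 1 : ℝ) * x (σ i) / M)).sup (fun i => (i : ℕ) + 1))
    {R : Finset (Fin M)}
    (hR : R = (Finset.univ.filter (fun i : Fin M => (i : ℕ) + 1 ≤ k)).image σ)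
    {j : Fin M} (hj : j ∈ R) : (M : ℝ) ≤ α * R.card * x j := by
  have hM' : (0 : ℝ) < M := by exact_mod_cast hM
  subst hR
  obtain ⟨i, hi, rfl⟩ := Finset.mem_image.1 hj
  have hik : (i : ℕ) + 1 ≤ k := (Finset.mem_filter.1 hi).2
  have hne : (Finset.univ.filter
      (fun i : Fin M => 1 / α ≤ ((i : ℕ) + 1 : ℝ) * x (σ i) / M)).Nonempty := by
    by_contra h
    rw [Finset.not_nonempty_iff_eq_empty.1 h, Finset.sup_empty] at hk
    simp only [Nat.bot_eq_zero] at hk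
    omega
  obtain ⟨l, hl, hlk⟩ := Finset.exists_mem_eq_sup _ hne (fun i : Fin M => (i : ℕ) + 1)
  rw [← hk] at hlk
  have hfilter : Finset.univ.filter (fun i : Fin M => (i : ℕ) + 1 ≤ k) = Finset.Iic l := by
    ext a
    simp only [Finset.mem_filter, Finset.mem_univ, true_and, Finset.mem_Iic, Fin.le_def]
    omega
  have hle : x (σ l) ≤ x (σ i) := hσ i l (by rw [Fin.le_def]; omega)
  have hthr := (Finset.mem_filter.1 hl).2
  rw [div_le_div_iff₀ hα hM', one_mul] at hthr
  rw [Finset.card_image_of_injective _ σ.injective, hfilter, Fin.card_Iic]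
  push_cast
  calc (M : ℝ) ≤ ((l : ℕ) + 1 : ℝ) * x (σ l) * α := hthr
    _ = α * ((l : ℕ) + 1 : ℝ) * x (σ l) := by ring
    _ ≤ α * ((l : ℕ) + 1 : ℝ) * x (σ i) := by gcongr

/-- The false discovery proportion of a self-consistent set is at most `α / M` times the sum of the
null e-values. -/
theorem fdp_le_sum_of_self_consistent {M : ℕ} (hM : 1 ≤ M) {α : ℝ} (hα : 0 < α)
    {x : Fin M → ℝ} (hx : ∀ i, 0 ≤ x i) {R : Finset (Fin M)} (N : Finset (Fin M))
    (hR : ∀ i ∈ R, (M : ℝ) ≤ α * R.card * x i) :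
    ((R ∩ N).card : ℝ) / max (R.card : ℝ) 1 ≤ ∑ i ∈ N, α / M * x i := by
  have hM' : (0 : ℝ) < M := by exact_mod_cast hM
  calc ((R ∩ N).card : ℝ) / max (R.card : ℝ) 1
      = ∑ _i ∈ R ∩ N, 1 / max (R.card : ℝ) 1 := by
        rw [Finset.sum_const, nsmul_eq_mul, mul_one_div]
    _ ≤ ∑ i ∈ R ∩ N, α / M * x i := by
        refine Finset.sum_le_sum fun i hi => ?_
        have hiR := Finset.mem_of_mem_inter_left hi
        have hcard : (1 : ℝ) ≤ R.card := by exact_mod_cast Finset.card_pos.2 ⟨i, hiR⟩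
        rw [max_eq_left hcard, div_mul_eq_mul_div, div_le_div_iff₀ (by linarith) hM']
        linarith [hR i hiR]
    _ ≤ ∑ i ∈ N, α / M * x i :=
        Finset.sum_le_sum_of_subset_of_nonneg Finset.inter_subset_right
          fun i _ _ => mul_nonneg (by positivity) (hx i)

/-- The e-BH FDR-control guarantee (Wang–Ramdas): given `M` arbitrarily dependent
nonnegative statistics `e 1, …, e M` that are genuine e-values for the true nulls
`N ⊆ {1, …, M}`, sort them from largest to smallest via a measurable permutation `σ`, set
`k⋆ = max {m : m · e_{σ(m)} / M ≥ 1/α}` (`k⋆ = 0` if the set is empty), and reject the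
`k⋆` hypotheses with the largest e-values. Then the false discovery rate
`E[|R ∩ N| / max(|R|, 1)]` is at most `α |N| / M`, and hence at most `α`. -/
theorem eBH_FDR_control {Ω : Type*} [MeasurableSpace Ω] (μ : Measure Ω)
    [IsProbabilityMeasure μ] (M : ℕ) (hM : 1 ≤ M) (e : Fin M → Ω → ℝ)
    (he_meas : ∀ m, Measurable (e m)) (he_nonneg : ∀ m ω, 0 ≤ e m ω)
    (N : Finset (Fin M))
    (he_val : ∀ i ∈ N, ∫⁻ ω, ENNReal.ofReal (e i ω) ∂μ ≤ 1)
    (α : ℝ) (hα : α ∈ Set.Ioo (0 : ℝ) 1)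
    (σ : Ω → Equiv.Perm (Fin M))
    (hσ_meas : ∀ p : Equiv.Perm (Fin M), MeasurableSet {ω | σ ω = p})
    (hσ_sort : ∀ ω, ∀ i j : Fin M, i ≤ j → e (σ ω j) ω ≤ e (σ ω i) ω)
    (kstar : Ω → ℕ)
    (hkstar : ∀ ω, kstar ω =
      (Finset.univ.filter
        (fun i : Fin M => 1 / α ≤ ((i : ℕ) + 1 : ℝ) * e (σ ω i) ω / M)).sup
        (fun i => (i : ℕ) + 1))
    (R : Ω → Finset (Fin M))
    (hR : ∀ ω, R ω =
      (Finset.univ.filter (fun i : Fin M => (i : ℕ) + 1 ≤ kstar ω)).image (σ ω))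
    (FDR : ENNReal)
    (hFDR : FDR = ∫⁻ ω,
      ENNReal.ofReal (((R ω ∩ N).card : ℝ) / max ((R ω).card : ℝ) 1) ∂μ) :
    FDR ≤ ENNReal.ofReal (α * N.card / M) ∧ FDR ≤ ENNReal.ofReal α := by
  have hM' : (0 : ℝ) < M := by exact_mod_cast hM
  have hα0 : 0 < α := hα.1
  have hc : 0 ≤ α / M := by positivity
  have hbound : FDR ≤ ENNReal.ofReal (α * N.card / M) := by
    calc FDR ≤ ∫⁻ ω, ∑ i ∈ N, ENNReal.ofReal (α / M) * ENNReal.ofReal (e i ω) ∂μ := by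
          rw [hFDR]
          refine lintegral_mono fun ω => ?_
          simp only [← ENNReal.ofReal_mul hc]
          rw [← ENNReal.ofReal_sum_of_nonneg fun i _ => mul_nonneg hc (he_nonneg i ω)]
          exact ENNReal.ofReal_le_ofReal <|
            fdp_le_sum_of_self_consistent hM hα0 (fun i => he_nonneg i ω) N fun _ hi =>
              eBH_self_consistent hM hα0 (fun i => e i ω) (σ ω) (hσ_sort ω) (hkstar ω) (hR ω) hi
      _ = ∑ i ∈ N, ENNReal.ofReal (α / M) * ∫⁻ ω, ENNReal.ofReal (e i ω) ∂μ := by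
          rw [lintegral_finsetSum _ fun i _ => (he_meas i).ennreal_ofReal.const_mul _]
          exact Finset.sum_congr rfl fun i _ => lintegral_const_mul _ (he_meas i).ennreal_ofReal
      _ ≤ ∑ _i ∈ N, ENNReal.ofReal (α / M) :=
          Finset.sum_le_sum fun i hi => mul_le_of_le_one_right' (he_val i hi)
      _ = ENNReal.ofReal (α * N.card / M) := by
          rw [Finset.sum_const, ← ENNReal.ofReal_nsmul, nsmul_eq_mul]
          congr 1
          ring
  refine ⟨hbound, hbound.trans (ENNReal.ofReal_le_ofReal ?_)⟩
  have hN : (N.card : ℝ) ≤ M := by exact_mod_cast card_finset_fin_le N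
  rw [div_le_iff₀ hM']
  gcongr
end
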